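/- Let F be a formula and C a clause that is set-blocked in F. Then C is redundant with respect to F, i.e., F \ {C} and F ∪ {C} are satisfiability equivalent. -/

import Mathlib

abbrev Var := ℕ
abbrev Lit := Var × Bool
abbrev Clause := Finset Lit
abbrev Formula := Set Clause

def Lit.compl (l : Lit) : Lit := (l.1, !l.2)

def Clause.isTaut (C : Clause) : Prop := ∃ l ∈ C, Lit.compl l ∈ C

abbrev Assign := Var → Bool

def litSat (τ : Assign) (l : Lit) : Prop := τ l.1 = l.2
def clauseSat (τ : Assign) (C : Clause) : Prop := ∃ l ∈ C, litSat τ l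
def formulaSat (τ : Assign) (F : Formula) : Prop := ∀ C ∈ F, clauseSat τ C
def satisfiable (F : Formula) : Prop := ∃ τ : Assign, formulaSat τ F
def satEquiv (F G : Formula) : Prop := satisfiable F ↔ satisfiable G
def redundant (F : Formula) (C : Clause) : Prop := satEquiv (F \ {C}) (F ∪ {C})

def env (F : Formula) (C : Clause) : Formula := {D ∈ F | ∃ l ∈ D, Lit.compl l ∈ C}
def clauseVars (C : Clause) : Set Var := {v | ∃ l ∈ C, l.1 = v}
def formulaVars (F : Formula) : Set Var := {v | ∃ D ∈ F, ∃ l ∈ D, l.1 = v}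
def extVars (F : Formula) (C : Clause) : Set Var := formulaVars (env F C) \ clauseVars C

def semBlocked (F : Formula) (C : Clause) : Prop :=
  ∀ τ : Assign, formulaSat τ (env F C) →
    ∃ τ' : Assign, formulaSat τ' (env F C ∪ {C}) ∧ ∀ v : Var, v ∉ clauseVars C → τ v = τ' v

def blocksLit (F : Formula) (C : Clause) (l : Lit) : Prop :=
  l ∈ C ∧ ∀ D ∈ F, Lit.compl l ∈ D → Clause.isTaut (C ∪ D.erase (Lit.compl l))
def litBlocked (F : Formula) (C : Clause) : Prop := ∃ l : Lit, blocksLit F C l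

def complSet (L : Finset Lit) : Finset Lit := L.image Lit.compl
def blocksSet (F : Formula) (C : Clause) (L : Finset Lit) : Prop :=
  L.Nonempty ∧ L ⊆ C ∧
    ∀ D ∈ F, (D ∩ complSet L).Nonempty → Clause.isTaut ((C \ L) ∪ complSet L ∪ D)
def setBlocked (F : Formula) (C : Clause) : Prop := ∃ L : Finset Lit, blocksSet F C L

abbrev PAssign := Var → Option Bool
def pdom (σ : PAssign) : Set Var := {v | σ v ≠ none}
def plitSat (σ : PAssign) (l : Lit) : Prop := σ l.1 = some l.2
def pclauseSat (σ : PAssign) (C : Clause) : Prop := ∃ l ∈ C, plitSat σ l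
def pformulaSat (σ : PAssign) (F : Formula) : Prop := ∀ C ∈ F, pclauseSat σ C
def restrictF (F : Formula) (σ : PAssign) : Formula := {D ∈ F | ¬ pclauseSat σ D}
def punion (σ₁ σ₂ : PAssign) : PAssign := fun v => (σ₁ v).orElse (fun _ => σ₂ v)

def superBlocked (F : Formula) (C : Clause) : Prop :=
  ∀ σ : PAssign, pdom σ = extVars F C → setBlocked (restrictF F σ) C

def litClauses (F : Formula) (l : Lit) : Formula := {D ∈ F | l ∈ D}
def resolvents (F : Formula) (x : Var) : Formula :=
  {R | ∃ C ∈ litClauses F (x, true), ∃ D ∈ litClauses F (x, false),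
    R = C.erase (x, true) ∪ D.erase (x, false) ∧ ¬ Clause.isTaut R}
def elimVar (F : Formula) (x : Var) : Formula :=
  (F \ (litClauses F (x, true) ∪ litClauses F (x, false))) ∪ resolvents F x

def asymLit (F : Formula) (C : Clause) (l : Lit) : Prop :=
  ∃ D : Clause, D ⊆ C ∧ insert (Lit.compl l) D ∈ F \ {C}
def asymTaut (F : Formula) (C : Clause) : Prop :=
  ∃ ls : List Lit, Clause.isTaut (C ∪ ls.toFinset) ∧
    ∀ i : Fin ls.length, asymLit F (C ∪ (ls.take i.val).toFinset) (ls.get i)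
def ratPair (F : Formula) (C : Clause) : Prop :=
  asymTaut F C ∨
    ∃ l ∈ C, ∀ D ∈ F, Lit.compl l ∈ D → asymTaut F (C ∪ D.erase (Lit.compl l))

/-- Flip the variables of `τ` so that every literal of `L` becomes true (for consistent `L`),
leaving the other variables unchanged. -/
def makeTrue (L : Finset Lit) (τ : Assign) : Assign := fun v =>
  if (v, true) ∈ L then true else if (v, false) ∈ L then false else τ v

theorem litSat_or_litSat_compl (τ : Assign) (l : Lit) : litSat τ l ∨ litSat τ (Lit.compl l) := by
  obtain ⟨v, b⟩ := l
  simp only [litSat, Lit.compl]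
  cases τ v <;> cases b <;> simp

/-- A tautology is satisfied by every assignment. -/
theorem Clause.isTaut.clauseSat {C : Clause} (h : C.isTaut) (τ : Assign) : clauseSat τ C := by
  obtain ⟨l, hl, hl'⟩ := h
  exact (litSat_or_litSat_compl τ l).elim (fun h => ⟨l, hl, h⟩) (fun h => ⟨_, hl', h⟩)

theorem litSat_makeTrue_iff {L : Finset Lit} {τ : Assign} (hL : ¬ Clause.isTaut L) (l : Lit) :
    litSat (makeTrue L τ) l ↔ l ∈ L ∨ (Lit.compl l ∉ L ∧ litSat τ l) := by
  obtain ⟨v, b⟩ := l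
  have hcons : (v, true) ∈ L → (v, false) ∉ L := fun h₁ h₂ => hL ⟨_, h₁, h₂⟩
  by_cases h₁ : (v, true) ∈ L <;> by_cases h₂ : (v, false) ∈ L <;> cases b <;>
    simp_all [litSat, makeTrue, Lit.compl]

theorem Lit.compl_compl (l : Lit) : Lit.compl (Lit.compl l) = l := by
  simp [Lit.compl]

theorem mem_complSet {L : Finset Lit} {l : Lit} : l ∈ complSet L ↔ Lit.compl l ∈ L := by
  constructor
  · intro h
    obtain ⟨k, hk, rfl⟩ := Finset.mem_image.1 h
    rwa [Lit.compl_compl]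
  · exact fun h => Finset.mem_image.2 ⟨_, h, Lit.compl_compl l⟩

/-- If `L` blocks a falsified clause `C`, making `L` true preserves the satisfied clauses of `F`. -/
theorem blocksSet.clauseSat_makeTrue {F : Formula} {C D : Clause} {L : Finset Lit} {τ : Assign}
    (h : blocksSet F C L) (hC : ¬ clauseSat τ C) (hDF : D ∈ F) (hD : clauseSat τ D) :
    clauseSat (makeTrue L τ) D := by
  obtain ⟨-, hLC, hblock⟩ := h
  have hCtaut : ¬ Clause.isTaut C := fun h => hC (h.clauseSat τ)
  have hL : ¬ Clause.isTaut L := fun ⟨l, hl, hl'⟩ => hCtaut ⟨l, hLC hl, hLC hl'⟩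
  by_cases hne : (D ∩ complSet L).Nonempty
  · obtain ⟨k, hk, hsat⟩ := (hblock D hDF hne).clauseSat (makeTrue L τ)
    rw [Finset.mem_union, Finset.mem_union, Finset.mem_sdiff, mem_complSet] at hk
    refine ⟨k, ?_, hsat⟩
    rw [litSat_makeTrue_iff hL] at hsat
    rcases hk with (⟨hkC, hkL⟩ | hkL) | hkD
    · exact (hsat.elim hkL fun h => hC ⟨k, hkC, h.2⟩).elim
    · exact (hsat.elim (fun h => hL ⟨k, h, hkL⟩) fun h => h.1 hkL).elim
    · exact hkD
  · obtain ⟨k, hk, hsat⟩ := hD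
    refine ⟨k, hk, (litSat_makeTrue_iff hL k).2 (Or.inr ⟨fun hkL => hne ⟨k, ?_⟩, hsat⟩)⟩
    exact Finset.mem_inter.2 ⟨hk, mem_complSet.2 hkL⟩

theorem setBlocked_redundant (F : Formula) (C : Clause) (h : setBlocked F C) :
    redundant F C := by
  obtain ⟨L, hL⟩ := h
  refine ⟨fun ⟨τ, hτ⟩ => ?_, fun ⟨τ, hτ⟩ => ⟨τ, fun D hD => hτ D (Or.inl hD.1)⟩⟩
  by_cases hC : clauseSat τ C
  · refine ⟨τ, fun D hD => ?_⟩
    by_cases hDC : D = C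
    · rwa [hDC]
    · exact hτ D ⟨hD.resolve_right hDC, hDC⟩
  · refine ⟨makeTrue L τ, fun D hD => ?_⟩
    by_cases hDC : D = C
    · obtain ⟨l, hl⟩ := hL.1
      have hLtaut : ¬ Clause.isTaut L := fun ⟨k, hk, hk'⟩ =>
        hC (Clause.isTaut.clauseSat ⟨k, hL.2.1 hk, hL.2.1 hk'⟩ τ)
      exact ⟨l, hDC ▸ hL.2.1 hl, (litSat_makeTrue_iff hLtaut l).2 (Or.inl hl)⟩
    · have hDF : D ∈ F := hD.resolve_right hDC
      exact hL.clauseSat_makeTrue hC hDF (hτ D ⟨hDF, hDC⟩)
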